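/- Let n ≥ 3. Every permutation π ∈ M_{2n, C(2n−1,2)−4} lies in the orbit of the permutation [4 2 6 8 10 … 2n−2 1 3 5 … 2n−1] ∈ S_{2n−1} under the action generated by cyclic shifts C_a and translations T_b (a, b ∈ Z_{2n−1}); consequently |M_{2n, C(2n−1,2)−4}| = (2n−1)². -/

import Mathlib

/-- The representative of `x : ZMod n` in `{1, …, n}` (so `0` represents `n`). -/
def repr1 (n : ℕ) (x : ZMod n) : ℕ := if x = 0 then n else x.val

/-- Values of `ZMod n`, embedded into `ZMod (n+1)` via representatives in `{1, …, n}`. -/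
def emb (n : ℕ) (x : ZMod n) : ZMod (n + 1) := (repr1 n x : ZMod (n + 1))

/-- `L 0 = 0` and `L i = π(i)` for `i ∈ {1,…,n}`: the listing used to build
the cycle `Y_π = (π(n) π(n−1) … π(1) 0)`. -/
def listFun (n : ℕ) (π : Equiv.Perm (ZMod n)) : ZMod (n + 1) → ZMod (n + 1) :=
  fun i => if i = 0 then 0 else emb n (π (i.val : ZMod n))

/-- The inverse listing of `listFun`. -/
def listInv (n : ℕ) (π : Equiv.Perm (ZMod n)) : ZMod (n + 1) → ZMod (n + 1) :=
  fun y => if y = 0 then 0 else emb n (π.symm (y.val : ZMod n))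

/-- The cycle `Y_π = (π(n) π(n−1) … π(1) 0)` on `{0,1,…,n}`, as a function:
it sends `L(i)` to `L(i-1)`. -/
def Yfun (n : ℕ) (π : Equiv.Perm (ZMod n)) : ZMod (n + 1) → ZMod (n + 1) :=
  fun y => listFun n π (listInv n π y - 1)

/-- `C_π = Y_π ∘ X_n`, where `X_n` is the cycle `(0 1 2 … n)`, i.e. `x ↦ x + 1`. -/
def Cfun (n : ℕ) (π : Equiv.Perm (ZMod n)) : ZMod (n + 1) → ZMod (n + 1) :=
  fun x => Yfun n π (x + 1)

/-- The strategic pile of `π ∈ S_n`: the set of values appearing strictly after `n` and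
strictly before `0` on the cycle of `C_π` containing `0` and `n` (empty if `0` and `n`
lie in different cycles). -/
def strategicPile (n : ℕ) (π : Equiv.Perm (ZMod n)) : Set (ZMod (n + 1)) :=
  {x | ∃ k m : ℕ, 0 < k ∧ k < m ∧ (Cfun n π)^[m] (n : ZMod (n + 1)) = 0 ∧
      (∀ j, 0 < j → j < m → (Cfun n π)^[j] (n : ZMod (n + 1)) ≠ 0) ∧
      (Cfun n π)^[k] (n : ZMod (n + 1)) = x}

/-- `π ∈ S_n` has maximal strategic pile. -/
def MaxPile (n : ℕ) (π : Equiv.Perm (ZMod n)) : Prop :=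
  (Even n ∧ (strategicPile n π).ncard = n - 1) ∨
  (Odd n ∧ (strategicPile n π).ncard = n - 2)

/-- The position (in `{1,…,n}`) of the value `v` in `π`. -/
def idx (n : ℕ) (π : Equiv.Perm (ZMod n)) (v : ZMod n) : ℕ := repr1 n (π.symm v)

/-- Word coordinate of the occurrence of the pointer `(p,p+1)` as the right pointer of the
entry `p`:  the entry at position `i` is given word coordinate `3*i - 1`, its left pointer
coordinate `3*i - 2` and its right pointer coordinate `3*i`. -/
def posR (n : ℕ) (π : Equiv.Perm (ZMod n)) (p : ZMod n) : ℕ := 3 * idx n π p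

/-- Word coordinate of the occurrence of the pointer `(p,p+1)` as the left pointer of the
entry `p+1`. -/
def posL (n : ℕ) (π : Equiv.Perm (ZMod n)) (p : ZMod n) : ℕ := 3 * idx n π (p + 1) - 2

/-- Two pairs of positions interleave (pattern `a b a b` or `b a b a`). -/
def Interleaved (a1 a2 b1 b2 : ℕ) : Prop :=
  (min a1 a2 < min b1 b2 ∧ min b1 b2 < max a1 a2 ∧ max a1 a2 < max b1 b2) ∨
  (min b1 b2 < min a1 a2 ∧ min a1 a2 < max b1 b2 ∧ max b1 b2 < max a1 a2)

/-- `(p, q)` is a valid pointer context for `π`: the two pointers are distinct and their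
occurrences in the pointer word of `π` appear in the order `p,q,p,q` or `q,p,q,p`. -/
def ValidContext (n : ℕ) (π : Equiv.Perm (ZMod n)) (p q : ZMod n) : Prop :=
  p ≠ q ∧ Interleaved (posR n π p) (posL n π p) (posR n π q) (posL n π q)

/-- The number of (unordered) valid pointer contexts of `π`. -/
noncomputable def numContexts (n : ℕ) (π : Equiv.Perm (ZMod n)) : ℕ :=
  {pq : ZMod n × ZMod n | ValidContext n π pq.1 pq.2}.ncard / 2

/-- `ρ ∈ S_{2n−1}` is the contraction of `π ∈ S_{2n}`, obtained by deleting the entry `2n`. -/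
def IsContraction (n : ℕ) (ρ : Equiv.Perm (ZMod (2 * n - 1)))
    (π : Equiv.Perm (ZMod (2 * n))) : Prop :=
  ∃ m : ℕ, 1 ≤ m ∧ m ≤ 2 * n ∧ π (m : ZMod (2 * n)) = ((2 * n : ℕ) : ZMod (2 * n)) ∧
    (∀ k : ℕ, 1 ≤ k → k < m →
      ρ (k : ZMod (2 * n - 1)) =
        ((repr1 (2 * n) (π (k : ZMod (2 * n))) : ℕ) : ZMod (2 * n - 1))) ∧
    (∀ k : ℕ, m ≤ k → k ≤ 2 * n - 1 →
      ρ (k : ZMod (2 * n - 1)) =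
        ((repr1 (2 * n) (π ((k + 1 : ℕ) : ZMod (2 * n))) : ℕ) : ZMod (2 * n - 1)))

/-- `M_{2n}`: the contractions of permutations in `S_{2n}` with maximal strategic pile. -/
def MsetAll (n : ℕ) : Set (Equiv.Perm (ZMod (2 * n - 1))) :=
  {ρ | ∃ π : Equiv.Perm (ZMod (2 * n)), MaxPile (2 * n) π ∧ IsContraction n ρ π}

/-- `M_{2n,k}`: the contractions of permutations in `S_{2n}` with maximal strategic pile
and exactly `k` valid pointer contexts. -/
def Mset (n k : ℕ) : Set (Equiv.Perm (ZMod (2 * n - 1))) :=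
  {ρ | ρ ∈ MsetAll n ∧ numContexts (2 * n - 1) ρ = k}

/-- Cyclic shift by `a`: `C_a(π)(x) = π(x - a)`. -/
def Cshift (n : ℕ) (a : ZMod n) (π : Equiv.Perm (ZMod n)) : Equiv.Perm (ZMod n) :=
  (Equiv.subRight a).trans π

/-- Translation by `b`: `T_b(π)(x) = π(x) + b`. -/
def Tshift (n : ℕ) (b : ZMod n) (π : Equiv.Perm (ZMod n)) : Equiv.Perm (ZMod n) :=
  π.trans (Equiv.addRight b)

/-- `φ(a,b,π) = C_a(T_b(π))`, i.e. `x ↦ π(x-a) + b`. -/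
def phiAct (n : ℕ) (a b : ZMod n) (π : Equiv.Perm (ZMod n)) : Equiv.Perm (ZMod n) :=
  Cshift n a (Tshift n b π)

/-- The difference sequence of `π`. -/
def Dseq (n : ℕ) (π : Equiv.Perm (ZMod n)) : ZMod n → ZMod n :=
  fun k => π (k + 1) - π k

/-- The difference sequence of `π` is periodic with (least) period `p`, `0 < p < n`. -/
def PeriodicWith (n : ℕ) (π : Equiv.Perm (ZMod n)) (p : ℕ) : Prop :=
  0 < p ∧ p < n ∧ (∀ k : ZMod n, Dseq n π (k + (p : ZMod n)) = Dseq n π k) ∧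
    ∀ q : ℕ, 0 < q → q < p → ¬ ∀ k : ZMod n, Dseq n π (k + (q : ZMod n)) = Dseq n π k

theorem repr1_pos {N : ℕ} [NeZero N] (x : ZMod N) : 1 ≤ repr1 N x := by
  unfold repr1
  split_ifs with h
  · exact NeZero.one_le
  · exact Nat.one_le_iff_ne_zero.2 (by simpa using h)

theorem repr1_le {N : ℕ} [NeZero N] (x : ZMod N) : repr1 N x ≤ N := by
  unfold repr1
  split_ifs with h
  · exact le_rfl
  · exact x.val_lt.le

@[simp]
theorem natCast_repr1 {N : ℕ} [NeZero N] (x : ZMod N) : ((repr1 N x : ℕ) : ZMod N) = x := by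
  unfold repr1
  split_ifs with h <;> simp [h]

theorem repr1_injective (N : ℕ) [NeZero N] : Function.Injective (repr1 N) := fun x y h => by
  rw [← natCast_repr1 x, h, natCast_repr1]

theorem repr1_natCast {N : ℕ} [NeZero N] {k : ℕ} (h1 : 1 ≤ k) (h2 : k ≤ N) :
    repr1 N (k : ZMod N) = k := by
  rcases h2.lt_or_eq with h | rfl
  · have : (k : ZMod N) ≠ 0 := fun h0 => by
      have := congrArg ZMod.val h0
      rw [ZMod.val_natCast_of_lt h] at this
      simp at this
      omega
    rw [repr1, if_neg this, ZMod.val_natCast_of_lt h]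
  · simp [repr1]

/-- Subtraction in `ZMod N` on representatives. -/
theorem val_sub_eq_ite {N : ℕ} [NeZero N] (x y : ZMod N) :
    (x - y).val = if y.val ≤ x.val then x.val - y.val else x.val + N - y.val := by
  have hx := x.val_lt
  have hy := y.val_lt
  have h : x - y = ((x.val + N - y.val : ℕ) : ZMod N) := by
    rw [Nat.cast_sub (by omega)]; simp
  rw [h, ZMod.val_natCast]
  split_ifs with hle
  · rw [show x.val + N - y.val = (x.val - y.val) + N by omega, Nat.add_mod_right,
      Nat.mod_eq_of_lt (by omega)]
  · exact Nat.mod_eq_of_lt (by omega)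

/-- Addition in `ZMod N` on representatives. -/
theorem val_add_eq_ite {N : ℕ} [NeZero N] (x y : ZMod N) :
    (x + y).val = if x.val + y.val < N then x.val + y.val else x.val + y.val - N := by
  have hx := x.val_lt
  have hy := y.val_lt
  rw [ZMod.val_add]
  split_ifs with h
  · exact Nat.mod_eq_of_lt h
  · rw [Nat.mod_eq_sub_mod (by omega), Nat.mod_eq_of_lt (by omega)]

theorem val_eq_repr1 {N : ℕ} [NeZero N] (x : ZMod N) :
    x.val = if repr1 N x = N then 0 else repr1 N x := by
  have := x.val_lt
  unfold repr1
  by_cases h : x = 0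
  · simp [h]
  · simp only [h, if_false]; rw [if_neg (by omega)]

theorem val_one_of_lt {N : ℕ} (h : 1 < N) : (1 : ZMod N).val = 1 := by
  simpa using ZMod.val_natCast_of_lt h

theorem two_mul_cast {N n : ℕ} (hN : N + 1 = 2 * n) : (2 : ZMod N) * n = 1 := by
  have := congrArg (Nat.cast : ℕ → ZMod N) hN
  push_cast at this
  simpa using this.symm

/-- Going along the cyclic word from the right pointer of the entry at position `i`, the other
occurrence of that pointer is met right after position `gapPerm π i`. -/
def gapPerm {N : ℕ} (π : Equiv.Perm (ZMod N)) : Equiv.Perm (ZMod N) :=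
  (π.trans (Equiv.addRight 1)).trans (π.symm.trans (Equiv.subRight 1))

theorem gapPerm_apply {N : ℕ} (π : Equiv.Perm (ZMod N)) (i : ZMod N) :
    gapPerm π i = π.symm (π i + 1) - 1 := rfl

theorem apply_gapPerm {N : ℕ} (π : Equiv.Perm (ZMod N)) (i : ZMod N) :
    π (gapPerm π i + 1) = π i + 1 := by
  simp [gapPerm_apply]

/-- The chords `i` and `j` of the cyclic chord diagram of `s` (the chord `i` joins the point `i`
to the point just after `s i`) are distinct and do not cross. -/
def Noncrossing {N : ℕ} (s : Equiv.Perm (ZMod N)) (i j : ZMod N) : Prop :=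
  i ≠ j ∧ ((j - i).val ≤ (s i - i).val ↔ (s j - i).val < (s i - i).val)

instance {N : ℕ} (s : Equiv.Perm (ZMod N)) (i j : ZMod N) : Decidable (Noncrossing s i j) := by
  unfold Noncrossing; infer_instance

theorem Noncrossing.symm {N : ℕ} [NeZero N] {s : Equiv.Perm (ZMod N)} {i j : ZMod N}
    (h : Noncrossing s i j) : Noncrossing s j i := by
  obtain ⟨hij, h⟩ := h
  refine ⟨hij.symm, ?_⟩
  have h1 : i.val ≠ j.val := fun h => hij (ZMod.val_injective N h)
  have h2 : (s i).val ≠ (s j).val := fun h => hij (s.injective (ZMod.val_injective N h))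
  have := i.val_lt
  have := j.val_lt
  have := (s i).val_lt
  have := (s j).val_lt
  simp only [val_sub_eq_ite] at h ⊢
  split_ifs at h ⊢ <;> omega

theorem validContext_iff {N : ℕ} (hN : 1 < N) (π : Equiv.Perm (ZMod N)) (p q : ZMod N) :
    ValidContext N π p q ↔
      p ≠ q ∧ ¬ Noncrossing (gapPerm π) (π.symm p) (π.symm q) := by
  have : NeZero N := ⟨by omega⟩
  unfold ValidContext
  refine and_congr_right fun hpq => ?_
  have h0 : π.symm p ≠ π.symm q := fun h => hpq (π.symm.injective h)
  have h1 : idx N π p ≠ idx N π q := fun h => h0 (repr1_injective N h)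
  have h2 : idx N π (p + 1) ≠ idx N π (q + 1) := fun h =>
    hpq (add_right_cancel (π.symm.injective (repr1_injective N h)))
  have a1 : 1 ≤ idx N π p := repr1_pos _
  have a2 : 1 ≤ idx N π q := repr1_pos _
  have a3 : 1 ≤ idx N π (p + 1) := repr1_pos _
  have a4 : 1 ≤ idx N π (q + 1) := repr1_pos _
  have b1 : idx N π p ≤ N := repr1_le _
  have b2 : idx N π q ≤ N := repr1_le _
  have b3 : idx N π (p + 1) ≤ N := repr1_le _
  have b4 : idx N π (q + 1) ≤ N := repr1_le _
  have key : ∀ x : ZMod N, (π.symm x).val = if idx N π x = N then 0 else idx N π x :=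
    fun x => val_eq_repr1 _
  have key1 : ∀ x : ZMod N, (π.symm x - 1).val = idx N π x - 1 := fun x => by
    rw [val_sub_eq_ite, val_one_of_lt hN, key x]
    have : 1 ≤ idx N π x := repr1_pos _
    split_ifs <;> omega
  simp only [Noncrossing, h0, ne_eq, not_false_eq_true, true_and, gapPerm_apply,
    Equiv.apply_symm_apply]
  rw [val_sub_eq_ite (π.symm q), val_sub_eq_ite (π.symm (p + 1) - 1),
    val_sub_eq_ite (π.symm (q + 1) - 1), key1, key1, key, key]
  simp only [Interleaved, posR, posL]
  generalize idx N π p = r at *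
  generalize idx N π q = r' at *
  generalize idx N π (p + 1) = l at *
  generalize idx N π (q + 1) = l' at *
  split_ifs <;> omega

theorem card_filter_val {N : ℕ} [NeZero N] (f : Equiv.Perm (ZMod N)) (P : ℕ → Prop)
    [DecidablePred P] :
    (Finset.univ.filter fun j => P (f j).val).card = ((Finset.range N).filter P).card := by
  refine Finset.card_bij (fun j _ => (f j).val) ?_ ?_ ?_
  · intro j hj
    simpa [ZMod.val_lt] using hj
  · intro a _ b _ h
    exact f.injective (ZMod.val_injective N h)
  · intro k hk
    simp only [Finset.mem_filter, Finset.mem_range] at hk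
    refine ⟨f.symm k, ?_, ?_⟩ <;> simp [ZMod.val_natCast_of_lt hk.1, hk.2]

/-- The number of chords that do not cross the chord `i`. -/
def noncrossingDeg {N : ℕ} [NeZero N] (s : Equiv.Perm (ZMod N)) (i : ZMod N) : ℕ :=
  (Finset.univ.filter fun j => Noncrossing s i j).card

/-- A chord cutting off `d` left and `d` right pointers has as many non-crossing chords on the
one side as on the other, up to the difference of the sizes of the two sides. -/
theorem exists_noncrossingDeg_eq {N : ℕ} [NeZero N] (s : Equiv.Perm (ZMod N)) (i : ZMod N) :
    ∃ a b : ℕ, noncrossingDeg s i = a + b ∧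
      a + (N - 1) = b + 2 * (s i - i).val := by
  have hN : 1 ≤ N := NeZero.one_le
  have hd := (s i - i).val_lt
  set d := (s i - i).val with hd_def
  let E : Finset (ZMod N) := Finset.univ.erase i
  let U : Finset (ZMod N) := Finset.univ.filter fun j => 1 ≤ (j - i).val ∧ (j - i).val ≤ d
  let V : Finset (ZMod N) := Finset.univ.filter fun j => (s j - i).val < d
  have hE : E.card = N - 1 := by simp [E, ZMod.card]
  have hU : U.card = d := by
    have := card_filter_val (Equiv.subRight i) (fun k => 1 ≤ k ∧ k ≤ d)
    simp only [Equiv.subRight_apply] at this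
    rw [show U.card = _ from this, show (Finset.range N).filter (fun k => 1 ≤ k ∧ k ≤ d)
      = Finset.Icc 1 d by ext; simp; omega]
    simp
  have hV : V.card = d := by
    have := card_filter_val (s.trans (Equiv.subRight i)) (fun k => k < d)
    simp only [Equiv.trans_apply, Equiv.subRight_apply] at this
    rw [show V.card = _ from this, show (Finset.range N).filter (fun k => k < d)
      = Finset.range d by ext; simp; omega]
    simp
  have hpos : ∀ j, j ≠ i → 1 ≤ (j - i).val := fun j hj =>
    Nat.one_le_iff_ne_zero.2 (by simpa [sub_eq_zero] using hj)
  have hUE : U ⊆ E := fun j hj => by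
    simp only [U, E, Finset.mem_filter, Finset.mem_erase, Finset.mem_univ, true_and,
      and_true] at hj ⊢
    rintro rfl
    simp at hj
  have hVE : V ⊆ E := fun j hj => by
    simp only [V, E, Finset.mem_filter, Finset.mem_erase, Finset.mem_univ, true_and,
      and_true] at hj ⊢
    rintro rfl
    omega
  have hset : (Finset.univ.filter fun j => Noncrossing s i j) = (U ∩ V) ∪ (E \ (U ∪ V)) := by
    ext j
    by_cases hj : j = i
    · subst hj
      simp only [Finset.mem_filter]
      simp [Noncrossing, U, E]
    · have := hpos j hj
      simp only [Noncrossing, U, V, E, Finset.mem_filter, Finset.mem_erase, Finset.mem_univ,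
        Finset.mem_union, Finset.mem_inter, Finset.mem_sdiff, true_and, and_true, hj,
        not_false_eq_true, ne_eq, this, Ne.symm hj, ← hd_def]
      tauto
  have hdisj : Disjoint (U ∩ V) (E \ (U ∪ V)) := by
    rw [Finset.disjoint_left]
    intro j hj hj'
    simp only [Finset.mem_inter, Finset.mem_sdiff, Finset.mem_union] at hj hj'
    tauto
  refine ⟨(U ∩ V).card, (E \ (U ∪ V)).card, ?_, ?_⟩
  · rw [noncrossingDeg, hset, Finset.card_union_of_disjoint hdisj]
  · have h1 := Finset.card_union_add_card_inter U V
    have h2 := Finset.card_sdiff_add_card_eq_card (Finset.union_subset hUE hVE)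
    omega

theorem ncard_validContext_add_sum {N : ℕ} [NeZero N] (hN : 1 < N) (π : Equiv.Perm (ZMod N)) :
    {pq : ZMod N × ZMod N | ValidContext N π pq.1 pq.2}.ncard
      + ∑ i, noncrossingDeg (gapPerm π) i = N * (N - 1) := by
  let A : Finset (ZMod N × ZMod N) :=
    Finset.univ.filter fun x => x.1 ≠ x.2 ∧ ¬ Noncrossing (gapPerm π) x.1 x.2
  let B : Finset (ZMod N × ZMod N) :=
    Finset.univ.filter fun x => Noncrossing (gapPerm π) x.1 x.2
  have hA : {pq : ZMod N × ZMod N | ValidContext N π pq.1 pq.2}.ncard = A.card := by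
    have : {pq : ZMod N × ZMod N | ValidContext N π pq.1 pq.2}
        = (π.prodCongr π) '' (A : Set (ZMod N × ZMod N)) := by
      ext ⟨p, q⟩
      rw [Equiv.image_eq_preimage_symm]
      simp [A, validContext_iff hN]
    rw [this, Set.ncard_image_of_injective _ (Equiv.injective _), Set.ncard_coe_finset]
  have hB : ∑ i, noncrossingDeg (gapPerm π) i = B.card := by
    simp only [noncrossingDeg, B, Finset.card_filter]
    rw [Fintype.sum_prod_type]
  have hAB : A ∪ B = (Finset.univ : Finset (ZMod N)).offDiag := by
    ext ⟨p, q⟩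
    have : Noncrossing (gapPerm π) p q → p ≠ q := fun h => h.1
    simp only [A, B, Finset.mem_union, Finset.mem_filter, Finset.mem_univ, true_and,
      Finset.mem_offDiag]
    tauto
  have hdisj : Disjoint A B := by
    rw [Finset.disjoint_left]
    intro x hx hx'
    simp only [A, B, Finset.mem_filter] at hx hx'
    tauto
  rw [hA, hB, ← Finset.card_union_of_disjoint hdisj, hAB, Finset.offDiag_card]
  simp [ZMod.card, Nat.mul_sub]

theorem numContexts_eq_iff {N n : ℕ} [NeZero N] (hN : N + 1 = 2 * n) (hn : 3 ≤ n)
    (π : Equiv.Perm (ZMod N)) :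
    numContexts N π = N.choose 2 - 4 ↔ ∑ i, noncrossingDeg (gapPerm π) i = 8 := by
  have h1 := ncard_validContext_add_sum (by omega) π
  have h2 : Even (∑ i, noncrossingDeg (gapPerm π) i) := by
    refine Finset.even_sum _ fun i _ => ?_
    obtain ⟨a, b, h, h'⟩ := exists_noncrossingDeg_eq (gapPerm π) i
    rw [h, Nat.even_iff]
    omega
  have h3 : Even (N * (N - 1)) := Nat.even_mul_pred_self N
  have h4 : 5 * 4 ≤ N * (N - 1) := Nat.mul_le_mul (by omega) (by omega)
  rw [numContexts, Nat.choose_two_right]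
  rw [Nat.even_iff] at h2 h3
  omega

/-- The map exchanging `i` with `i + 1` and `i + n` with `i + n + 1`. -/
def doubleSwap {N : ℕ} (n : ℕ) (i j : ZMod N) : ZMod N :=
  if j = i then i + 1 else if j = i + 1 then i else
    if j = i + n then i + n + 1 else if j = i + n + 1 then i + n else j

theorem val_eq_of_eq_natCast {N : ℕ} {x : ZMod N} {k : ℕ} (h : x = k) (hk : k < N) :
    x.val = k := by
  rw [h, ZMod.val_natCast_of_lt hk]

theorem natCast_ne_natCast {N a b : ℕ} (ha : a < N) (hb : b < N) (hab : a ≠ b) :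
    (a : ZMod N) ≠ b := fun h => hab <| by
  rw [← ZMod.val_natCast_of_lt ha, h, ZMod.val_natCast_of_lt hb]

/-- A permutation of `ZMod N` with a fixed point that moves every point by at most one step
consists of exchanges of neighbours. -/
theorem apply_add_eq_of_step {N : ℕ} [NeZero N] (t : Equiv.Perm (ZMod N)) {ε : ZMod N}
    (hε : ε * ε = 1) (h2 : (2 : ZMod N) ≠ 0)
    (ht : ∀ j, t j = j ∨ t j = j + ε ∨ t j = j - ε) {j₀ : ZMod N} (h0 : t j₀ = j₀)
    {i : ZMod N} (hi : t i = i + ε) : t (i + ε) = i := by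
  have hε0 : ε ≠ 0 := fun h => h2 <| by
    have h1 : (1 : ZMod N) = 0 := by rw [← hε, h, zero_mul]
    rw [← one_add_one_eq_two, h1, add_zero]
  have h2ε : ε + ε ≠ 0 := fun h => h2 <| by linear_combination ε * h - 2 * hε
  by_contra hne
  have key : ∀ k : ℕ, t (i + k * ε) = i + k * ε + ε ∧ t (i + k * ε + ε) = i + k * ε + ε + ε := by
    intro k
    induction k with
    | zero =>
      simp only [Nat.cast_zero, zero_mul, add_zero]
      refine ⟨hi, ?_⟩
      rcases ht (i + ε) with h | h | h
      · exact absurd (t.injective (h.trans hi.symm)) (by simpa using hε0)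
      · exact h
      · exact absurd (by simpa using h) hne
    | succ k ih =>
      obtain ⟨h1, h3⟩ := ih
      have e : i + ((k + 1 : ℕ) : ZMod N) * ε = i + k * ε + ε := by push_cast; ring
      rw [e]
      refine ⟨h3, ?_⟩
      rcases ht (i + k * ε + ε + ε) with h | h | h
      · exact absurd (t.injective (h.trans h3.symm)) (by simpa using hε0)
      · exact h
      · rw [add_sub_cancel_right] at h
        have := t.injective (h.trans h1.symm)
        exact absurd this (by simpa [add_assoc] using h2ε)
  have := (key (ε * (j₀ - i)).val).1
  rw [ZMod.natCast_zmod_val, show i + ε * (j₀ - i) * ε = j₀ by linear_combination (j₀ - i) * hε,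
    h0] at this
  exact hε0 (by simpa using this)

/-- A chord with at most two non-crossing chords is within one step of being a diameter. -/
theorem apply_eq_of_noncrossingDeg_le_two {N n : ℕ} [NeZero N] (hN : N + 1 = 2 * n) (hn : 3 ≤ n)
    (s : Equiv.Perm (ZMod N)) (i : ZMod N) (h : noncrossingDeg s i ≤ 2) :
    (s i = i + n - 1 ∨ s i = i + 1 + n - 1 ∨ s i = i - 1 + n - 1) ∧
      (noncrossingDeg s i = 0 → s i = i + n - 1) := by
  obtain ⟨a, b, hab, hd⟩ := exists_noncrossingDeg_eq s i
  have hs : s i = i + ((s i - i).val : ZMod N) := by simp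
  generalize (s i - i).val = d at hs hd
  have e1 : d = n - 1 → s i = i + n - 1 := fun h => by
    rw [hs, h, Nat.cast_sub (by omega)]; push_cast; ring
  refine ⟨?_, fun h0 => e1 (by omega)⟩
  have : d = n - 1 ∨ d = n ∨ d = n - 2 := by omega
  rcases this with h | h | h
  · exact Or.inl (e1 h)
  · right; left; rw [hs, h]; ring
  · right; right; rw [hs, h, Nat.cast_sub (by omega)]; push_cast; ring

theorem exists_noncrossing_of_noncrossingDeg_ne_zero {N : ℕ} [NeZero N] {s : Equiv.Perm (ZMod N)}
    {i : ZMod N} (h : noncrossingDeg s i ≠ 0) : ∃ j, Noncrossing s i j := by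
  obtain ⟨j, hj⟩ := Finset.card_ne_zero.1 h
  exact ⟨j, (Finset.mem_filter.1 hj).2⟩

theorem Noncrossing.noncrossingDeg_ne_zero {N : ℕ} [NeZero N] {s : Equiv.Perm (ZMod N)}
    {i j : ZMod N} (h : Noncrossing s i j) : noncrossingDeg s i ≠ 0 :=
  Finset.card_ne_zero.2 ⟨j, Finset.mem_filter.2 ⟨Finset.mem_univ _, h⟩⟩

theorem even_noncrossingDeg {N : ℕ} [NeZero N] (hN : Odd N) (s : Equiv.Perm (ZMod N))
    (i : ZMod N) : Even (noncrossingDeg s i) := by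
  obtain ⟨a, b, h, h'⟩ := exists_noncrossingDeg_eq s i
  rw [h, Nat.even_iff]
  rw [Nat.odd_iff] at hN
  omega

theorem noncrossingDeg_le_two {N : ℕ} [NeZero N] (hN : Odd N) (s : Equiv.Perm (ZMod N))
    (hsum : ∑ i, noncrossingDeg s i = 8) (i : ZMod N) : noncrossingDeg s i ≤ 2 := by
  by_contra! h
  have heven := even_noncrossingDeg hN s
  have h4 : 4 ≤ noncrossingDeg s i := by
    have := heven i
    rw [Nat.even_iff] at this
    omega
  let A := Finset.univ.filter fun j => Noncrossing s i j
  have hA : A.card = noncrossingDeg s i := rfl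
  have hi : i ∉ A := fun h => (Finset.mem_filter.1 h).2.1 rfl
  have h1 : ∑ j ∈ insert i A, noncrossingDeg s j ≤ 8 :=
    hsum ▸ Finset.sum_le_sum_of_subset (Finset.subset_univ _)
  have h2 : A.card • 2 ≤ ∑ j ∈ A, noncrossingDeg s j := by
    refine Finset.card_nsmul_le_sum _ _ _ fun j hj => ?_
    have h0 := (Finset.mem_filter.1 hj).2.symm.noncrossingDeg_ne_zero
    have := heven j
    rw [Nat.even_iff] at this
    omega
  rw [Finset.sum_insert hi] at h1
  simp only [smul_eq_mul] at h2
  omega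

theorem card_noncrossingDeg_ne_zero {N : ℕ} [NeZero N] (hN : Odd N) (s : Equiv.Perm (ZMod N))
    (hsum : ∑ i, noncrossingDeg s i = 8) :
    (Finset.univ.filter fun i => noncrossingDeg s i ≠ 0).card = 4 := by
  have h : ∑ i ∈ Finset.univ.filter (fun i => noncrossingDeg s i ≠ 0), noncrossingDeg s i = 8 := by
    rw [Finset.sum_filter_ne_zero, hsum]
  rw [Finset.sum_congr rfl (g := fun _ => 2), Finset.sum_const, smul_eq_mul] at h
  · omega
  · intro i hi
    have h0 := (Finset.mem_filter.1 hi).2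
    have := noncrossingDeg_le_two hN s hsum i
    have := even_noncrossingDeg hN s i
    rw [Nat.even_iff] at this
    omega

/-- If all chords are diameters, then all of them cross. -/
theorem not_noncrossing_of_diameters {N n : ℕ} [NeZero N] (hN : N + 1 = 2 * n) (hn : 3 ≤ n)
    {s : Equiv.Perm (ZMod N)} {i j : ZMod N} (hi : s i = i + n - 1) (hj : s j = j + n - 1) :
    ¬ Noncrossing s i j := by
  rintro ⟨hij, h⟩
  have hc : ((n - 1 : ℕ) : ZMod N) = n - 1 := by
    rw [Nat.cast_sub (by omega)]; simp
  have e1 : (s i - i).val = n - 1 :=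
    val_eq_of_eq_natCast (by rw [hi, hc]; ring) (by omega)
  have e2 : s j - i = (j - i) + ((n - 1 : ℕ) : ZMod N) := by rw [hj, hc]; ring
  have e3 : (j - i).val ≠ 0 := by simpa [sub_eq_zero] using hij.symm
  have := (j - i).val_lt
  rw [e1, e2, val_add_eq_ite, ZMod.val_natCast_of_lt (by omega)] at h
  split_ifs at h <;> omega

/-- Four pairs of non-crossing chords determine the chord diagram up to rotation. -/
theorem exists_eq_doubleSwap {N n : ℕ} [NeZero N] (hN : N + 1 = 2 * n) (hn : 3 ≤ n)
    (s : Equiv.Perm (ZMod N)) (hsum : ∑ i, noncrossingDeg s i = 8) :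
    ∃ i, ∀ j, s j = doubleSwap n i j + n - 1 := by
  have hodd : Odd N := ⟨n - 1, by omega⟩
  have hle := noncrossingDeg_le_two hodd s hsum
  have hcard := card_noncrossingDeg_ne_zero hodd s hsum
  have hnn : (n : ZMod N) + n = 1 := by rw [← two_mul_cast hN]; ring
  have h2 : (2 : ZMod N) ≠ 0 := by
    simpa using natCast_ne_natCast (N := N) (a := 2) (b := 0) (by omega) (by omega) (by omega)
  have h1 : (1 : ZMod N) ≠ 0 := by
    simpa using natCast_ne_natCast (N := N) (a := 1) (b := 0) (by omega) (by omega) (by omega)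
  have hn0 : (n : ZMod N) ≠ 0 := by
    simpa using natCast_ne_natCast (N := N) (a := n) (b := 0) (by omega) (by omega) (by omega)
  have hn1 : (n : ZMod N) ≠ 1 := by
    simpa using natCast_ne_natCast (N := N) (a := n) (b := 1) (by omega) (by omega) (by omega)
  have hns : (n : ZMod N) + 1 ≠ 0 := by
    simpa using natCast_ne_natCast (N := N) (a := n + 1) (b := 0) (by omega) (by omega) (by omega)
  have five : ∀ F : Finset (ZMod N), (∀ x ∈ F, noncrossingDeg s x ≠ 0) → F.card ≤ 4 := fun F hF =>
    hcard ▸ Finset.card_le_card fun x hx => by simpa using hF x hx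
  have three : ∀ (x : ZMod N) (F : Finset (ZMod N)), (∀ y ∈ F, Noncrossing s x y) →
      F.card ≤ 2 := fun x F hF =>
    (Finset.card_le_card fun y hy => by simpa using hF y hy).trans (hle x)
  let t : Equiv.Perm (ZMod N) := s.trans (Equiv.subRight ((n : ZMod N) - 1))
  have hst : ∀ j, s j = t j + n - 1 := fun j => by simp [t]; ring
  have hstep : ∀ j, t j = j ∨ t j = j + 1 ∨ t j = j - 1 := fun j => by
    have := (apply_eq_of_noncrossingDeg_le_two hN hn s j (hle j)).1
    simpa only [hst, sub_left_inj, add_left_inj] using this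
  have hfix : ∀ j, noncrossingDeg s j = 0 → t j = j := fun j hj => by
    have := (apply_eq_of_noncrossingDeg_le_two hN hn s j (hle j)).2 hj
    simpa only [hst, sub_left_inj, add_left_inj] using this
  have hmoved : ∀ j, t j ≠ j → noncrossingDeg s j ≠ 0 := fun j hj h => hj (hfix j h)
  obtain ⟨j₀, hj₀⟩ : ∃ j, t j = j := by
    by_contra! h
    have := five Finset.univ fun x _ => hmoved x (h x)
    rw [Finset.card_univ, ZMod.card] at this
    omega
  have hswap : ∀ i, t i = i + 1 → t (i + 1) = i := fun i hi =>
    apply_add_eq_of_step t (one_mul 1) h2 hstep hj₀ hi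
  have hswap' : ∀ i, t i = i - 1 → t (i - 1) = i := fun i hi => by
    have := apply_add_eq_of_step t (ε := -1) (by ring) h2
      (fun j => by rcases hstep j with h | h | h <;> simp [h, sub_eq_add_neg]) hj₀
      (hi.trans (sub_eq_add_neg _ _))
    rwa [← sub_eq_add_neg] at this
  have double : ∀ i, t i = i + 1 → t (i + n) = i + n + 1 →
      ∃ i, ∀ j, s j = doubleSwap n i j + n - 1 := by
    intro i hi hin
    refine ⟨i, fun j => ?_⟩
    rw [hst, sub_left_inj, add_left_inj]
    have hi' := hswap i hi
    have hin' := hswap _ hin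
    unfold doubleSwap
    split_ifs with c1 c2 c3 c4
    · rw [c1, hi]
    · rw [c2, hi']
    · rw [c3, hin]
    · rw [c4, hin']
    · by_contra hj
      have := five {j, i, i + 1, i + n, i + n + 1} (by
        simp only [Finset.mem_insert, Finset.mem_singleton]
        rintro x (rfl | rfl | rfl | rfl | rfl)
        · exact hmoved _ hj
        · exact hmoved _ (by rw [hi]; simpa using h1)
        · exact hmoved _ (by rw [hi']; simpa using h1)
        · exact hmoved _ (by rw [hin]; simpa using h1)
        · exact hmoved _ (by rw [hin']; simpa using h1))
      rw [Finset.card_insert_of_notMem (by simp [c1, c2, c3, c4]),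
        Finset.card_insert_of_notMem (by simp [h1, hn0, add_assoc, hns]),
        Finset.card_insert_of_notMem (by simp [hn1.symm, hn0, add_assoc, add_comm (n : ZMod N)]),
        Finset.card_insert_of_notMem (by simp [h1]), Finset.card_singleton] at this
      omega
  obtain ⟨i, hi⟩ : ∃ i, t i = i + 1 := by
    by_contra! h
    have hid : ∀ j, t j = j := fun j => by
      rcases hstep j with h' | h' | h'
      · exact h'
      · exact absurd h' (h j)
      · exact absurd ((hswap' j h').trans (by ring)) (h (j - 1))
    have : ∑ i, noncrossingDeg s i = 0 := Finset.sum_eq_zero fun j _ => by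
      by_contra h0
      obtain ⟨k, hk⟩ := exists_noncrossing_of_noncrossingDeg_ne_zero h0
      exact not_noncrossing_of_diameters hN hn (by rw [hst, hid]) (by rw [hst, hid]) hk
    omega
  have hi' := hswap i hi
  rcases hstep (i + n) with hin | hin | hin
  · exfalso
    have hc : ∀ k, k ≤ n → ((n - k : ℕ) : ZMod N) = n - k := fun k hk => Nat.cast_sub hk
    have v1 : (s i - i).val = n :=
      val_eq_of_eq_natCast (by rw [hst, hi]; ring) (by omega)
    have v2 : (s (i + 1) - (i + 1)).val = n - 2 :=
      val_eq_of_eq_natCast (by rw [hst, hi', hc 2 (by omega)]; push_cast; ring) (by omega)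
    have v3 : (s (i + 1) - i).val = n - 1 :=
      val_eq_of_eq_natCast (by rw [hst, hi', hc 1 (by omega)]; push_cast; ring) (by omega)
    have v4 : (s (i + n) - i).val = 0 :=
      val_eq_of_eq_natCast (by rw [hst, hin]; push_cast; linear_combination hnn) (by omega)
    have v5 : (s (i + n) - (i + 1)).val = N - 1 :=
      val_eq_of_eq_natCast (by
        rw [hst, hin, Nat.cast_sub (by omega)]; simp; linear_combination hnn) (by omega)
    have w1 : (i + 1 - i).val = 1 :=
      val_eq_of_eq_natCast (by push_cast; ring) (by omega)
    have w2 : (i + n - i).val = n :=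
      val_eq_of_eq_natCast (by ring) (by omega)
    have w3 : (i + n - (i + 1)).val = n - 1 :=
      val_eq_of_eq_natCast (by rw [hc 1 (by omega)]; push_cast; ring) (by omega)
    have c1 : Noncrossing s i (i + 1) :=
      ⟨by simpa using h1, by rw [v1, v3, w1]; omega⟩
    have c2 : Noncrossing s i (i + n) :=
      ⟨by simpa using hn0, by rw [v1, v4, w2]; omega⟩
    have c3 : Noncrossing s (i + 1) (i + n) :=
      ⟨by simpa using hn1.symm, by rw [v2, v5, w3]; omega⟩
    let T : Finset (ZMod N) := {i, i + 1, i + n}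
    have hT : T.card = 3 := Finset.card_eq_three.2 ⟨_, _, _, c1.1, c2.1, c3.1, rfl⟩
    obtain ⟨k, hk, hkT⟩ := Finset.exists_mem_notMem_of_card_lt_card (s := T)
      (t := Finset.univ.filter fun i => noncrossingDeg s i ≠ 0) (by omega)
    have hk0 := (Finset.mem_filter.1 hk).2
    have hTne : ∀ x ∈ T, noncrossingDeg s x ≠ 0 := by
      simp only [T, Finset.mem_insert, Finset.mem_singleton]
      rintro x (rfl | rfl | rfl)
      exacts [c1.noncrossingDeg_ne_zero, c3.noncrossingDeg_ne_zero,
        c2.symm.noncrossingDeg_ne_zero]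
    obtain ⟨m, hm⟩ := exists_noncrossing_of_noncrossingDeg_ne_zero hk0
    have hTtwo : ∀ x ∈ T, ∀ y ∈ T, x ≠ y → Noncrossing s x y := by
      simp only [T, Finset.mem_insert, Finset.mem_singleton]
      rintro x (rfl | rfl | rfl) y (rfl | rfl | rfl) hxy
      exacts [absurd rfl hxy, c1, c2, c1.symm, absurd rfl hxy, c3, c2.symm, c3.symm,
        absurd rfl hxy]
    by_cases hmT : m ∈ T
    · have := three m (insert k (T.erase m)) (by
        intro y hy
        rcases Finset.mem_insert.1 hy with rfl | hy
        · exact hm.symm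
        · exact hTtwo m hmT y (Finset.mem_of_mem_erase hy) (Finset.ne_of_mem_erase hy).symm)
      rw [Finset.card_insert_of_notMem (fun h => hkT (Finset.mem_of_mem_erase h)),
        Finset.card_erase_of_mem hmT] at this
      omega
    · have := five (insert k (insert m T)) (by
        intro y hy
        rcases Finset.mem_insert.1 hy with rfl | hy
        · exact hk0
        · rcases Finset.mem_insert.1 hy with rfl | hy
          · exact hm.symm.noncrossingDeg_ne_zero
          · exact hTne y hy)
      rw [Finset.card_insert_of_notMem (by simp [hkT, hm.1]),
        Finset.card_insert_of_notMem hmT] at this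
      omega
  · exact double i hi hin
  · refine double (i + n - 1) ((hswap' _ hin).trans (by ring)) ?_
    rw [show i + n - 1 + n = i by linear_combination hnn, hi]

theorem card_filter_val_sub_mem {N : ℕ} [NeZero N] (i : ZMod N) (F : Finset ℕ)
    (hF : ∀ k ∈ F, k < N) :
    (Finset.univ.filter fun j : ZMod N => (j - i).val ∈ F).card = F.card := by
  have := card_filter_val (Equiv.subRight i) (fun k => k ∈ F)
  simp only [Equiv.subRight_apply] at this
  rw [this]
  congr 1
  ext k
  simp only [Finset.mem_filter, Finset.mem_range, and_iff_right_iff_imp]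
  exact hF k

theorem doubleSwap_eq_add_natCast {N n : ℕ} [NeZero N] (hN : N + 1 = 2 * n) (hn : 3 ≤ n)
    (i y : ZMod N) :
    doubleSwap n i y = i + ((if (y - i).val = 0 then 1 else if (y - i).val = 1 then 0 else
      if (y - i).val = n then n + 1 else if (y - i).val = n + 1 then n else (y - i).val : ℕ) :
        ZMod N) := by
  have h : ∀ k : ℕ, k < N → (y = i + k ↔ (y - i).val = k) := fun k hk => by
    rw [← sub_eq_iff_eq_add']
    exact ⟨fun h => val_eq_of_eq_natCast h hk, fun h => by rw [← h, ZMod.natCast_zmod_val]⟩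
  have h0 := h 0 (by omega)
  have h1 := h 1 (by omega)
  have h2 := h n (by omega)
  have h3 := h (n + 1) (by omega)
  simp only [Nat.cast_zero, add_zero, Nat.cast_one, Nat.cast_add, ← add_assoc] at h0 h1 h2 h3
  simp only [doubleSwap, h0, h1, h2, h3]
  split_ifs <;> simp [add_assoc]

theorem noncrossing_iff_of_doubleSwap {N n : ℕ} [NeZero N] (hN : N + 1 = 2 * n) (hn : 3 ≤ n)
    {s : Equiv.Perm (ZMod N)} {i : ZMod N} (hs : ∀ j, s j = doubleSwap n i j + n - 1)
    (x y : ZMod N) :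
    Noncrossing s x y ↔
      (x - i).val ∈ ({0, n + 1} : Finset ℕ) ∧ (y - i).val ∈ ({1, n} : Finset ℕ) ∨
      (x - i).val ∈ ({1, n} : Finset ℕ) ∧ (y - i).val ∈ ({0, n + 1} : Finset ℕ) := by
  have hxy : x ≠ y ↔ (x - i).val ≠ (y - i).val := by
    rw [Ne, Ne, (ZMod.val_injective N).eq_iff, sub_left_inj]
  have key : ∀ z, s z - x = ((s z - i) - (x - i)) := fun z => by ring
  have key2 : ∀ z, (s z - i) = ((if (z - i).val = 0 then 1 else if (z - i).val = 1 then 0 else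
      if (z - i).val = n then n + 1 else if (z - i).val = n + 1 then n else (z - i).val : ℕ) :
        ZMod N) + ((n - 1 : ℕ) : ZMod N) := fun z => by
    rw [hs, doubleSwap_eq_add_natCast hN hn, Nat.cast_sub (by omega : 1 ≤ n), Nat.cast_one]
    ring
  have key3 : ∀ z, (s z - i).val =
      if (z - i).val = 0 then n else if (z - i).val = 1 then n - 1 else
      if (z - i).val = n then 1 else if (z - i).val = n + 1 then 0 else
      if (z - i).val + n ≤ N then (z - i).val + n - 1 else (z - i).val + n - 1 - N := fun z => by
    have hz := (z - i).val_lt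
    rw [key2, val_add_eq_ite, ZMod.val_natCast_of_lt (by split_ifs <;> omega),
      ZMod.val_natCast_of_lt (by omega)]
    generalize (z - i).val = u at *
    split_ifs <;> omega
  have key4 : ∀ z, (z - i).val = 0 ∧ (s z - i).val = n ∨ (z - i).val = 1 ∧ (s z - i).val = n - 1 ∨
      (z - i).val = n ∧ (s z - i).val = 1 ∨ (z - i).val = n + 1 ∧ (s z - i).val = 0 ∨
      (z - i).val ≠ 0 ∧ (z - i).val ≠ 1 ∧ (z - i).val ≠ n ∧ (z - i).val ≠ n + 1 ∧
        ((z - i).val + n ≤ N ∧ (s z - i).val = (z - i).val + n - 1 ∨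
          N < (z - i).val + n ∧ (s z - i).val + N = (z - i).val + n - 1) := fun z => by
    rw [key3]
    generalize (z - i).val = u
    split_ifs <;> omega
  have hsub : ∀ z w : ZMod N, w.val ≤ z.val ∧ (z - w).val + w.val = z.val ∨
      z.val < w.val ∧ (z - w).val + w.val = z.val + N := fun z w => by
    have := w.val_lt
    rw [val_sub_eq_ite]
    split_ifs <;> omega
  have hx := (x - i).val_lt
  have hy := (y - i).val_lt
  have hX := key4 x
  have hY := key4 y
  have s1 := hsub (y - i) (x - i)
  have s2 := hsub (s x - i) (x - i)
  have s3 := hsub (s y - i) (x - i)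
  rw [Noncrossing, hxy, key, key y, show y - x = (y - i) - (x - i) by ring]
  simp only [Finset.mem_insert, Finset.mem_singleton]
  generalize ((y - i) - (x - i)).val = p at *
  generalize ((s x - i) - (x - i)).val = q at *
  generalize ((s y - i) - (x - i)).val = r at *
  generalize (s x - i).val = a at *
  generalize (s y - i).val = b at *
  generalize (x - i).val = u at *
  generalize (y - i).val = v at *
  clear key key2 key3 key4 hsub hs hxy
  rcases hX with ⟨rfl, rfl⟩ | ⟨rfl, rfl⟩ | ⟨rfl, rfl⟩ | ⟨rfl, rfl⟩ | ⟨hu0, hu1, hu2, hu3, hX⟩ <;>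
  rcases hY with ⟨rfl, rfl⟩ | ⟨rfl, rfl⟩ | ⟨rfl, rfl⟩ | ⟨rfl, rfl⟩ | ⟨hv0, hv1, hv2, hv3, hY⟩ <;>
  omega

theorem sum_noncrossingDeg_of_doubleSwap {N n : ℕ} [NeZero N] (hN : N + 1 = 2 * n) (hn : 3 ≤ n)
    {s : Equiv.Perm (ZMod N)} {i : ZMod N} (hs : ∀ j, s j = doubleSwap n i j + n - 1) :
    ∑ x, noncrossingDeg s x = 8 := by
  have h1 : ({0, n + 1} : Finset ℕ).card = 2 := Finset.card_pair (by omega)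
  have h2 : ({1, n} : Finset ℕ).card = 2 := Finset.card_pair (by omega)
  have hdeg : ∀ x, noncrossingDeg s x =
      if (x - i).val ∈ ({0, n + 1, 1, n} : Finset ℕ) then 2 else 0 := fun x => by
    unfold noncrossingDeg
    simp only [noncrossing_iff_of_doubleSwap hN hn hs]
    by_cases c1 : (x - i).val ∈ ({0, n + 1} : Finset ℕ)
    · have c2 : (x - i).val ∉ ({1, n} : Finset ℕ) := by
        simp only [Finset.mem_insert, Finset.mem_singleton] at c1 ⊢; omega
      simp only [c1, c2, true_and, false_and, or_false]
      rw [card_filter_val_sub_mem i _ (by simp; omega), h2, if_pos]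
      simp only [Finset.mem_insert, Finset.mem_singleton] at c1 ⊢; omega
    · by_cases c2 : (x - i).val ∈ ({1, n} : Finset ℕ)
      · simp only [c1, c2, true_and, false_and, false_or]
        rw [card_filter_val_sub_mem i _ (by simp; omega), h1, if_pos]
        simp only [Finset.mem_insert, Finset.mem_singleton] at c2 ⊢; omega
      · simp only [c1, c2, false_and, or_false, Finset.filter_false, Finset.card_empty]
        rw [if_neg]
        simp only [Finset.mem_insert, Finset.mem_singleton] at c1 c2 ⊢; omega
  simp only [hdeg]
  rw [← Finset.sum_filter, Finset.sum_const, card_filter_val_sub_mem i _ (by simp; omega),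
    Finset.card_insert_of_notMem (by simp; omega), Finset.card_insert_of_notMem (by simp; omega),
    h2]
  rfl

/-- The map `x ↦ 2 x` on `ZMod N`, for `N = 2 n - 1`. -/
def doubling {N n : ℕ} (hN : N + 1 = 2 * n) : Equiv.Perm (ZMod N) where
  toFun x := 2 * x
  invFun x := n * x
  left_inv x := by linear_combination x * two_mul_cast hN
  right_inv x := by linear_combination x * two_mul_cast hN

/-- The permutation `[4 2 6 8 … 2n-2 1 3 5 … 2n-1]`, shifted by `a` and translated by `b`. -/
def orbitPerm {N n : ℕ} (hN : N + 1 = 2 * n) (a b : ZMod N) : Equiv.Perm (ZMod N) :=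
  ((Equiv.subRight a).trans (Equiv.swap 1 2)).trans ((doubling hN).trans (Equiv.addRight b))

theorem orbitPerm_apply {N n : ℕ} (hN : N + 1 = 2 * n) (a b x : ZMod N) :
    orbitPerm hN a b x =
      (if x - a = 1 then 4 else if x - a = 2 then 2 else 2 * (x - a)) + b := by
  simp only [orbitPerm, doubling, Equiv.trans_apply, Equiv.subRight_apply, Equiv.swap_apply_def,
    Equiv.coe_fn_mk, Equiv.coe_addRight, add_left_inj]
  split_ifs <;> norm_num

theorem small_ne_zero {N n : ℕ} (hN : N + 1 = 2 * n) (hn : 3 ≤ n) :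
    (1 : ZMod N) ≠ 0 ∧ (2 : ZMod N) ≠ 0 ∧ (3 : ZMod N) ≠ 0 := by
  refine ⟨?_, ?_, ?_⟩
  · simpa using natCast_ne_natCast (N := N) (a := 1) (b := 0) (by omega) (by omega) (by omega)
  · simpa using natCast_ne_natCast (N := N) (a := 2) (b := 0) (by omega) (by omega) (by omega)
  · simpa using natCast_ne_natCast (N := N) (a := 3) (b := 0) (by omega) (by omega) (by omega)

/-- `doubleSwap` in the coordinate `w` with `j = i - n w`. -/
theorem doubleSwap_sub_mul {N n : ℕ} (hN : N + 1 = 2 * n) (i w : ZMod N) :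
    doubleSwap n i (i - n * w) = i - n * (if w = 0 then -2 else if w = -2 then 0 else
      if w = -1 then -3 else if w = -3 then -1 else w) := by
  have h2n := two_mul_cast hN
  have e0 : i - n * w = i ↔ w = 0 :=
    ⟨fun h => by linear_combination -2 * h - w * h2n, fun h => by rw [h]; ring⟩
  have e1 : i - n * w = i + 1 ↔ w = -2 :=
    ⟨fun h => by linear_combination -2 * h - w * h2n,
      fun h => by rw [h]; linear_combination h2n⟩
  have e2 : i - n * w = i + n ↔ w = -1 :=
    ⟨fun h => by linear_combination -2 * h - (w + 1) * h2n, fun h => by rw [h]; ring⟩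
  have e3 : i - n * w = i + n + 1 ↔ w = -3 :=
    ⟨fun h => by linear_combination -2 * h - (w + 1) * h2n,
      fun h => by rw [h]; linear_combination h2n⟩
  simp only [doubleSwap, e0, e1, e2, e3]
  split_ifs
  · linear_combination -h2n
  · ring
  · linear_combination -h2n
  · ring
  · rfl

theorem doubleSwap_injective {N n : ℕ} (hN : N + 1 = 2 * n) (hn : 3 ≤ n) :
    Function.Injective (doubleSwap n : ZMod N → ZMod N → ZMod N) := by
  obtain ⟨h1, h2, h3⟩ := small_ne_zero hN hn
  have h2n := two_mul_cast hN
  intro i i' h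
  have ha : doubleSwap n i i = i + 1 := by simp [doubleSwap]
  have hb : doubleSwap n i (i + n) = i + n + 1 := by
    have := doubleSwap_sub_mul hN i (-1)
    have hne : (-1 : ZMod N) ≠ -2 := fun h => h1 (by linear_combination h)
    simp only [neg_eq_zero, h1, hne, if_true, if_false] at this
    rw [show i + n = i - n * (-1) by ring, this]
    linear_combination h2n
  rw [h] at ha hb
  unfold doubleSwap at ha
  split_ifs at ha with c1 c2 c3 c4
  · exact c1
  · exact absurd (by linear_combination -ha - c2) h2
  · have c : i + n = i' + 1 := by linear_combination c3 + h2n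
    rw [c] at hb
    simp only [doubleSwap, add_eq_left, h1, if_true, if_false] at hb
    exact absurd (by linear_combination -hb) h2
  · exact absurd (by linear_combination -ha - c4) h2
  · exact absurd (by linear_combination -ha) h1

theorem gapPerm_orbitPerm {N n : ℕ} (hN : N + 1 = 2 * n) (hn : 3 ≤ n) (a b j : ZMod N) :
    gapPerm (orbitPerm hN a b) j = doubleSwap n (a + (n : ZMod N)) j + n - 1 := by
  obtain ⟨h1, h2, h3⟩ := small_ne_zero hN hn
  have h2n := two_mul_cast hN
  rw [gapPerm_apply, sub_left_inj, Equiv.symm_apply_eq]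
  obtain ⟨w, rfl⟩ : ∃ w, j = a + n - n * w :=
    ⟨-(2 * (j - (a + n))), by linear_combination -(j - (a + n)) * h2n⟩
  rw [doubleSwap_sub_mul hN]
  have key : ∀ v : ZMod N, orbitPerm hN a b (a + n - n * v) =
      (if v = -1 then 4 else if v = -3 then 2 else 1 - v) + b := fun v => by
    have e1 : a + n - n * v - a = 1 ↔ v = -1 :=
      ⟨fun h => by linear_combination -2 * h + (1 - v) * h2n,
        fun h => by rw [h]; linear_combination h2n⟩
    have e2 : a + n - n * v - a = 2 ↔ v = -3 :=
      ⟨fun h => by linear_combination -2 * h + (1 - v) * h2n,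
        fun h => by rw [h]; linear_combination 2 * h2n⟩
    simp only [orbitPerm_apply, e1, e2]
    split_ifs
    · rfl
    · rfl
    · linear_combination (1 - v) * h2n
  rw [key, show a + n - n * (if w = 0 then -2 else if w = -2 then 0 else
      if w = -1 then -3 else if w = -3 then -1 else w) + n = a + n - n * ((if w = 0 then -2 else
      if w = -2 then 0 else if w = -1 then -3 else if w = -3 then -1 else w) - 1) by ring, key]
  have n1 : ¬ (0 : ZMod N) = -1 := fun h => h1 (by linear_combination h)
  have n2 : ¬ (0 : ZMod N) = -3 := fun h => h3 (by linear_combination h)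
  have n3 : ¬ (-2 : ZMod N) = -1 := fun h => h1 (by linear_combination -h)
  have n4 : ¬ (-2 : ZMod N) = -3 := fun h => h1 (by linear_combination h)
  have n5 : ¬ (-3 : ZMod N) = -1 := fun h => h2 (by linear_combination -h)
  by_cases w0 : w = 0
  · have : (-2 - 1 : ZMod N) ≠ -1 := fun h => h2 (by linear_combination -h)
    have : (-2 - 1 : ZMod N) = -3 := by ring
    simp only [w0, n1, n2, n5, this, if_true, if_false]
    ring
  by_cases w2 : w = -2
  · have : (0 - 1 : ZMod N) = -1 := by ring
    simp only [w2, n3, n4, this, if_true, if_false, neg_eq_zero, h2]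
    ring
  by_cases w1 : w = -1
  · have m1 : ¬ (-3 - 1 : ZMod N) = -1 := fun h => h3 (by linear_combination -h)
    have m2 : ¬ (-3 - 1 : ZMod N) = -3 := fun h => h1 (by linear_combination -h)
    have m3 : ¬ (-1 : ZMod N) = -2 := fun h => h1 (by linear_combination h)
    simp only [w1, m1, m2, m3, if_true, if_false, neg_eq_zero, h1]
    ring
  by_cases w3 : w = -3
  · have m1 : ¬ (-1 - 1 : ZMod N) = -1 := fun h => h1 (by linear_combination -h)
    have m2 : ¬ (-1 - 1 : ZMod N) = -3 := fun h => h1 (by linear_combination h)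
    have m3 : ¬ (-3 : ZMod N) = -2 := fun h => h1 (by linear_combination -h)
    simp only [w3, n5, m1, m2, m3, if_true, if_false, neg_eq_zero, h3]
    ring
  · have m1 : ¬ w - 1 = -1 := fun h => w0 (by linear_combination h)
    have m2 : ¬ w - 1 = -3 := fun h => w2 (by linear_combination h)
    simp only [w0, w1, w2, w3, m1, m2, if_false]
    ring

/-- `gapPerm` determines a permutation up to translation. -/
theorem exists_eq_add_of_gapPerm_eq {N : ℕ} [NeZero N] {π ρ : Equiv.Perm (ZMod N)}
    (h : ∀ j, gapPerm π j = gapPerm ρ j) : ∃ b, ∀ x, π x = ρ x + b := by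
  have hstep : ∀ j, π (ρ.symm (ρ j + 1)) = π j + 1 := fun j => by
    have := h j
    rw [gapPerm_apply, gapPerm_apply, sub_left_inj] at this
    rw [← this, Equiv.apply_symm_apply]
  have key : ∀ k : ℕ, π (ρ.symm (k : ZMod N)) = (k : ZMod N) + π (ρ.symm 0) := fun k => by
    induction k with
    | zero => simp
    | succ k ih =>
      have := hstep (ρ.symm k)
      rw [Equiv.apply_symm_apply, ih] at this
      push_cast
      rw [this]
      ring
  refine ⟨π (ρ.symm 0), fun x => ?_⟩
  simpa using key (ρ x).val

/-- The cyclic order in which the map `j ↦ doubleSwap n i j + n - 1` runs through `ZMod N`. -/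
def cyclicOrder {N n : ℕ} (hN : N + 1 = 2 * n) (i : ZMod N) : Equiv.Perm (ZMod N) :=
  (Equiv.swap 0 (-2)).trans ((doubling hN).symm.trans (Equiv.subLeft i))

theorem doubleSwap_cyclicOrder {N n : ℕ} (hN : N + 1 = 2 * n) (hn : 3 ≤ n) (i k : ZMod N) :
    doubleSwap n i (cyclicOrder hN i k) + n - 1 = cyclicOrder hN i (k + 1) := by
  obtain ⟨h1, h2, h3⟩ := small_ne_zero hN hn
  have h2n := two_mul_cast hN
  have e : ∀ k, cyclicOrder hN i k = i - n * Equiv.swap 0 (-2) k := fun k => rfl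
  rw [e, e, doubleSwap_sub_mul hN, Equiv.swap_apply_def, Equiv.swap_apply_def]
  have n1 : ¬ (-2 : ZMod N) = 0 := by simpa using h2
  have n2 : ¬ (-1 : ZMod N) = 0 := by simpa using h1
  have n3 : ¬ (-3 : ZMod N) = 0 := by simpa using h3
  have n4 : ¬ (-1 : ZMod N) = -2 := fun h => h1 (by linear_combination h)
  have n5 : ¬ (-3 : ZMod N) = -2 := fun h => h1 (by linear_combination -h)
  have n6 : ¬ (-3 : ZMod N) = -1 := fun h => h2 (by linear_combination -h)
  by_cases k0 : k = 0
  · have m : ¬ (0 + 1 : ZMod N) = -2 := fun h => h3 (by linear_combination h)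
    have m' : ¬ (0 + 1 : ZMod N) = 0 := by simpa using h1
    simp only [k0, n1, m, m', if_true, if_false]
    linear_combination h2n
  by_cases k2 : k = -2
  · have m : ¬ (-2 + 1 : ZMod N) = -2 := by simpa using h1
    have m' : ¬ (-2 + 1 : ZMod N) = 0 := fun h => h1 (by linear_combination -h)
    simp only [k2, n1, m, m', if_true, if_false]
    linear_combination h2n
  by_cases k1 : k = -1
  · have m : (-1 + 1 : ZMod N) = 0 := by ring
    simp only [k1, n2, n4, m, if_true, if_false]
    linear_combination h2n
  by_cases k3 : k = -3
  · have m : (-3 + 1 : ZMod N) = -2 := by ring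
    simp only [k3, n1, n3, n5, n6, m, if_true, if_false]
    linear_combination h2n
  · have m : ¬ k + 1 = 0 := fun h => k1 (by linear_combination h)
    have m' : ¬ k + 1 = -2 := fun h => k3 (by linear_combination h)
    simp only [k0, k1, k2, k3, m, m', if_false]
    linear_combination h2n

theorem natCast_succ_ne_zero {M k : ℕ} (h1 : 1 ≤ k) (h2 : k ≤ M) :
    ((k : ℕ) : ZMod (M + 1)) ≠ 0 := by
  simpa using natCast_ne_natCast (N := M + 1) (a := k) (b := 0) (by omega) (by omega) (by omega)

theorem Yfun_zero {M : ℕ} [NeZero M] (π : Equiv.Perm (ZMod M)) :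
    Yfun M π 0 = (repr1 M (π 0) : ZMod (M + 1)) := by
  have hM : 1 ≤ M := NeZero.one_le
  have h : (0 - 1 : ZMod (M + 1)) = (M : ZMod (M + 1)) := by
    have := ZMod.natCast_self (M + 1)
    push_cast at this
    linear_combination -this
  simp only [Yfun, listInv, if_true, h, listFun, emb]
  rw [if_neg (natCast_succ_ne_zero hM le_rfl), ZMod.val_natCast_of_lt (by omega),
    ZMod.natCast_self]

theorem Yfun_repr1 {M : ℕ} [NeZero M] (π : Equiv.Perm (ZMod M)) {k : ℕ} (h1 : 1 ≤ k)
    (h2 : k ≤ M) :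
    Yfun M π (repr1 M (π k) : ZMod (M + 1)) =
      if k = 1 then 0 else (repr1 M (π (k - 1 : ℕ)) : ZMod (M + 1)) := by
  have a1 := repr1_pos (π k)
  have a2 := repr1_le (π k)
  simp only [Yfun, listInv]
  rw [if_neg (natCast_succ_ne_zero a1 a2), ZMod.val_natCast_of_lt (by omega), natCast_repr1,
    Equiv.symm_apply_apply, emb, repr1_natCast h1 h2]
  split_ifs with hk
  · simp [hk, listFun]
  · have h : (k : ZMod (M + 1)) - 1 = ((k - 1 : ℕ) : ZMod (M + 1)) := by
      rw [Nat.cast_sub h1, Nat.cast_one]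
    rw [h, listFun, if_neg (natCast_succ_ne_zero (by omega) (by omega)),
      ZMod.val_natCast_of_lt (by omega), emb]

/-- The entries of the permutation obtained from `ρ` by inserting the largest entry `N + 1` at
position `m`. -/
def insertEntry {N : ℕ} (ρ : Equiv.Perm (ZMod N)) (m k : ℕ) : ℕ :=
  if k < m then repr1 N (ρ k) else if k = m then N + 1 else repr1 N (ρ (k - 1 : ℕ))

theorem exists_perm_insertEntry {N M : ℕ} [NeZero N] [NeZero M] (hM : M = N + 1)
    (ρ : Equiv.Perm (ZMod N)) {m : ℕ} (hm : 1 ≤ m) (hm' : m ≤ M) :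
    ∃ π : Equiv.Perm (ZMod M), ∀ k : ℕ, 1 ≤ k → k ≤ M →
      repr1 M (π k) = insertEntry ρ m k := by
  have hle : ∀ k, 1 ≤ insertEntry ρ m k ∧ insertEntry ρ m k ≤ M := fun k => by
    have a1 := repr1_pos (ρ k)
    have a2 := repr1_le (ρ k)
    have a3 := repr1_pos (ρ (k - 1 : ℕ))
    have a4 := repr1_le (ρ (k - 1 : ℕ))
    unfold insertEntry
    split_ifs <;> omega
  have hρ : ∀ k l : ℕ, 1 ≤ k → k ≤ N → 1 ≤ l → l ≤ N → repr1 N (ρ k) = repr1 N (ρ l) → k = l :=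
    fun k l hk hk' hl hl' h => by
      have := ρ.injective (repr1_injective N h)
      rw [← repr1_natCast hk hk', this, repr1_natCast hl hl']
  have hinj : ∀ k l, 1 ≤ k → k ≤ M → 1 ≤ l → l ≤ M →
      insertEntry ρ m k = insertEntry ρ m l → k = l := by
    intro k l hk hk' hl hl' h
    have a1 := repr1_le (ρ k)
    have a2 := repr1_le (ρ (k - 1 : ℕ))
    have a3 := repr1_le (ρ l)
    have a4 := repr1_le (ρ (l - 1 : ℕ))
    unfold insertEntry at h
    split_ifs at h
    · exact hρ k l hk (by omega) hl (by omega) h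
    · omega
    · have := hρ k (l - 1) hk (by omega) (by omega) (by omega) h
      omega
    · omega
    · omega
    · omega
    · have := hρ (k - 1) l (by omega) (by omega) hl (by omega) h
      omega
    · omega
    · have := hρ (k - 1) (l - 1) (by omega) (by omega) (by omega) (by omega) h
      omega
  let f : ZMod M → ZMod M := fun x => (insertEntry ρ m (repr1 M x) : ZMod M)
  have hf : Function.Injective f := fun x y hxy => by
    refine repr1_injective M (hinj _ _ (repr1_pos x) (repr1_le x) (repr1_pos y) (repr1_le y) ?_)
    rw [← repr1_natCast (hle (repr1 M x)).1 (hle (repr1 M x)).2,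
      ← repr1_natCast (hle (repr1 M y)).1 (hle (repr1 M y)).2]
    exact congrArg _ hxy
  refine ⟨Equiv.ofBijective f (Finite.injective_iff_bijective.1 hf), fun k hk hk' => ?_⟩
  rw [Equiv.ofBijective_apply]
  simp only [f]
  rw [repr1_natCast hk hk', repr1_natCast (hle k).1 (hle k).2]

/-- One step of the map `Cfun` of an extension of `ρ`. -/
theorem Cfun_insertEntry {N M : ℕ} [NeZero N] [NeZero M] (hM : M = N + 1) (hN : 1 < N)
    (ρ : Equiv.Perm (ZMod N)) (π : Equiv.Perm (ZMod M))
    (hπ : ∀ k : ℕ, 1 ≤ k → k ≤ M → repr1 M (π k) = insertEntry ρ (repr1 N (ρ.symm 1)) k)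
    (x : ZMod N) :
    Cfun M π (repr1 N x : ZMod (M + 1)) =
      if ρ.symm (x + 1) = 1 then 0 else
        (repr1 N (ρ (ρ.symm (x + 1) - 1)) : ZMod (M + 1)) := by
  set m := repr1 N (ρ.symm 1) with hm
  have hm1 : 1 ≤ m := repr1_pos _
  have hm2 : m ≤ N := repr1_le _
  have hr1 := repr1_pos (ρ.symm (x + 1))
  have hr2 := repr1_le (ρ.symm (x + 1))
  have hrc := natCast_repr1 (ρ.symm (x + 1))
  have hrone : ρ.symm (x + 1) = 1 ↔ repr1 N (ρ.symm (x + 1)) = 1 := by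
    have := repr1_natCast (N := N) (k := 1) le_rfl (by omega)
    rw [Nat.cast_one] at this
    rw [← (repr1_injective N).eq_iff, this]
  simp only [hrone]
  set r := repr1 N (ρ.symm (x + 1)) with hr
  have hρr : ρ r = x + 1 := by rw [hrc, Equiv.apply_symm_apply]
  have hprev : 1 < r → ρ.symm (x + 1) - 1 = ((r - 1 : ℕ) : ZMod N) := fun h => by
    rw [← hrc, Nat.cast_sub h.le, Nat.cast_one]
  have hY : ∀ k : ℕ, 1 ≤ k → k ≤ M → insertEntry ρ m k = repr1 N x + 1 →
      Cfun M π (repr1 N x : ZMod (M + 1)) =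
        if k = 1 then 0 else (insertEntry ρ m (k - 1) : ZMod (M + 1)) := by
    intro k hk hk' h
    have hx : (repr1 N x : ZMod (M + 1)) + 1 = (repr1 M (π k) : ZMod (M + 1)) := by
      rw [hπ k hk hk', h, Nat.cast_add, Nat.cast_one]
    rw [Cfun, hx, Yfun_repr1 π hk hk']
    split_ifs with h1
    · rfl
    · rw [hπ (k - 1) (by omega) (by omega)]
  have hx1 := repr1_pos x
  rcases (repr1_le x).lt_or_eq with hx | hx
  · have hval : repr1 N (x + 1) = repr1 N x + 1 := by
      rw [← repr1_natCast (N := N) (k := repr1 N x + 1) (by omega) (by omega)]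
      simp
    have hx0 : x ≠ 0 := by
      rintro rfl
      simp [repr1] at hx
    have hrm : r ≠ m := fun h => hx0 <| by
      have h' := ρ.symm.injective (repr1_injective N (hr.symm.trans (h.trans hm)))
      simpa using h'
    rcases hrm.lt_or_gt with h | h
    · rw [hY r hr1 (by omega) (by rw [insertEntry, if_pos h, hρr, hval])]
      split_ifs with h1
      · rfl
      · rw [insertEntry, if_pos (by omega), hprev (by omega)]
    · rw [hY (r + 1) (by omega) (by omega) (by
        rw [insertEntry, if_neg (by omega), if_neg (by omega), Nat.add_sub_cancel, hρr, hval]),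
        if_neg (by omega), if_neg (by omega), Nat.add_sub_cancel, insertEntry,
        if_neg (by omega), if_neg (by omega), hprev (by omega)]
  · have hx0 : x = 0 := by rw [← natCast_repr1 x, hx, ZMod.natCast_self]
    have hrm : r = m := by rw [hr, hm, hx0, zero_add]
    rw [hY m hm1 (by omega) (by simp [insertEntry, hx]), hrm]
    split_ifs with h1
    · rfl
    · rw [insertEntry, if_pos (by omega), hprev (by omega), hrm]

theorem ncard_strategicPile_of_insertEntry {N M : ℕ} [NeZero N] [NeZero M] (hM : M = N + 1)
    (hN : 1 < N) (ρ φ : Equiv.Perm (ZMod N)) (hφ : ∀ k, ρ (ρ.symm (φ k + 1) - 1) = φ (k + 1))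
    (π : Equiv.Perm (ZMod M))
    (hπ : ∀ k : ℕ, 1 ≤ k → k ≤ M → repr1 M (π k) = insertEntry ρ (repr1 N (ρ.symm 1)) k) :
    (strategicPile M π).ncard = N := by
  have hC := Cfun_insertEntry hM hN ρ π hπ
  have hm1 := repr1_pos (ρ.symm 1)
  have hm2 := repr1_le (ρ.symm 1)
  set lift : ZMod N → ZMod (M + 1) := fun x => (repr1 N x : ZMod (M + 1)) with hlift
  have hlift0 : ∀ x, lift x ≠ 0 := fun x =>
    natCast_succ_ne_zero (repr1_pos x) ((repr1_le x).trans (by omega))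
  have hliftinj : Function.Injective lift := fun x y h => repr1_injective N <| by
    have hx := repr1_le x
    have hy := repr1_le y
    by_contra hne
    exact natCast_ne_natCast (N := M + 1) (by omega) (by omega) hne h
  set k₀ := φ.symm (ρ 0) with hk₀
  have hφ0 : φ k₀ = ρ 0 := φ.apply_symm_apply _
  have hstart : Cfun M π (M : ZMod (M + 1)) = lift (φ k₀) := by
    have h0 : (M : ZMod (M + 1)) + 1 = 0 := by
      have := ZMod.natCast_self (M + 1)
      push_cast at this
      exact this
    have h1 := hπ M (by omega) le_rfl
    rw [ZMod.natCast_self, insertEntry, if_neg (by omega), if_neg (by omega),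
      show M - 1 = N by omega, ZMod.natCast_self] at h1
    rw [Cfun, h0, Yfun_zero, h1, hφ0]
  have hreturn : ∀ k, ρ.symm (φ k + 1) = 1 ↔ k + 1 = k₀ := fun k => by
    rw [← φ.injective.eq_iff (a := k + 1), ← hφ k, hφ0, ρ.injective.eq_iff, sub_eq_zero]
  have hiter : ∀ k : ℕ, k < N →
      (Cfun M π)^[k + 1] (M : ZMod (M + 1)) = lift (φ (k₀ + k)) := by
    intro k
    induction k with
    | zero => intro _; simpa using hstart
    | succ k ih =>
      intro hk
      have hne : ¬ k₀ + (k : ZMod N) + 1 = k₀ := by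
        rw [add_assoc, add_eq_left]
        have := natCast_ne_natCast (N := N) (a := k + 1) (b := 0) (by omega) (by omega) (by omega)
        simpa using this
      rw [Function.iterate_succ_apply', ih (by omega), hlift]
      simp only
      rw [hC, if_neg (by rwa [hreturn]), hφ, Nat.cast_add, Nat.cast_one, add_assoc]
  have hend : (Cfun M π)^[N + 1] (M : ZMod (M + 1)) = 0 := by
    obtain ⟨l, rfl⟩ : ∃ l, N = l + 1 := ⟨N - 1, by omega⟩
    rw [Function.iterate_succ_apply', hiter l (by omega), hlift]
    simp only
    rw [hC, if_pos]
    rw [hreturn, add_assoc, add_eq_left]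
    exact_mod_cast ZMod.natCast_self (l + 1)
  have hne : ∀ j, 0 < j → j < N + 1 → (Cfun M π)^[j] (M : ZMod (M + 1)) ≠ 0 := by
    intro j hj hj'
    obtain ⟨l, rfl⟩ : ∃ l, j = l + 1 := ⟨j - 1, by omega⟩
    rw [hiter l (by omega)]
    exact hlift0 _
  have hpile : strategicPile M π = lift '' Set.univ := by
    ext y
    constructor
    · rintro ⟨k, q, hk, hkq, hq, hq', rfl⟩
      have hqN : q ≤ N + 1 := by
        by_contra! h
        exact hq' (N + 1) (by omega) h hend
      obtain ⟨l, rfl⟩ : ∃ l, k = l + 1 := ⟨k - 1, by omega⟩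
      exact ⟨_, trivial, (hiter l (by omega)).symm⟩
    · rintro ⟨x, -, rfl⟩
      have hlt := (φ.symm x - k₀).val_lt
      refine ⟨(φ.symm x - k₀).val + 1, N + 1, by omega, by omega, hend, hne, ?_⟩
      rw [hiter _ hlt]
      simp
  rw [hpile, Set.ncard_image_of_injective _ hliftinj, Set.ncard_univ, Nat.card_zmod]

/-- If the map `x ↦ ρ (ρ⁻¹ (x + 1) - 1)` runs through all of `ZMod N` cyclically, then `ρ` is the
contraction of a permutation with maximal strategic pile. -/
theorem mem_MsetAll_of_cyclic {n : ℕ} (hn : 3 ≤ n) (ρ φ : Equiv.Perm (ZMod (2 * n - 1)))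
    (hφ : ∀ k, ρ (ρ.symm (φ k + 1) - 1) = φ (k + 1)) : ρ ∈ MsetAll n := by
  have hN' : 2 * n = (2 * n - 1) + 1 := by omega
  have : NeZero (2 * n - 1) := ⟨by omega⟩
  have : NeZero (2 * n) := ⟨by omega⟩
  have hm1 := repr1_pos (ρ.symm 1)
  have hm2 := repr1_le (ρ.symm 1)
  set m := repr1 (2 * n - 1) (ρ.symm 1) with hm
  obtain ⟨π, hπ⟩ := exists_perm_insertEntry hN' ρ (m := m) hm1 (by omega)
  have hlast := ncard_strategicPile_of_insertEntry hN' (by omega) ρ φ hφ π hπ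
  refine ⟨π, Or.inl ⟨even_two_mul n, by rw [hlast]⟩, m, hm1, by omega, ?_, ?_, ?_⟩
  · rw [← natCast_repr1 (π m), hπ m hm1 (by omega)]
    simp [insertEntry, ← hN']
  · intro k hk hkm
    rw [hπ k hk (by omega), insertEntry, if_pos hkm, natCast_repr1]
  · intro k hk hkm
    rw [hπ (k + 1) (by omega) (by omega), insertEntry, if_neg (by omega), if_neg (by omega),
      Nat.add_sub_cancel, natCast_repr1]

theorem orbitPerm_mem_Mset {n : ℕ} (hn : 3 ≤ n) (hN : 2 * n - 1 + 1 = 2 * n)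
    (a b : ZMod (2 * n - 1)) : orbitPerm hN a b ∈ Mset n ((2 * n - 1).choose 2 - 4) := by
  have : NeZero (2 * n - 1) := ⟨by omega⟩
  have hgap := gapPerm_orbitPerm hN hn a b
  refine ⟨mem_MsetAll_of_cyclic hn _
    ((cyclicOrder hN (a + n)).trans (orbitPerm hN a b)) fun k => ?_, ?_⟩
  · rw [Equiv.trans_apply, Equiv.trans_apply, ← gapPerm_apply, hgap, doubleSwap_cyclicOrder hN hn]
  · rw [numContexts_eq_iff hN hn]
    exact sum_noncrossingDeg_of_doubleSwap hN hn hgap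

theorem exists_eq_orbitPerm {n : ℕ} (hn : 3 ≤ n) (hN : 2 * n - 1 + 1 = 2 * n)
    {π : Equiv.Perm (ZMod (2 * n - 1))}
    (hπ : numContexts (2 * n - 1) π = (2 * n - 1).choose 2 - 4) :
    ∃ a b, orbitPerm hN a b = π := by
  have : NeZero (2 * n - 1) := ⟨by omega⟩
  obtain ⟨i, hi⟩ := exists_eq_doubleSwap hN hn _ ((numContexts_eq_iff hN hn π).1 hπ)
  obtain ⟨b, hb⟩ := exists_eq_add_of_gapPerm_eq (π := π) (ρ := orbitPerm hN (i - n) 0)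
    fun j => by rw [hi, gapPerm_orbitPerm hN hn, sub_add_cancel]
  refine ⟨i - n, b, Equiv.ext fun x => ?_⟩
  rw [hb, orbitPerm_apply, orbitPerm_apply, add_zero]

theorem orbitPerm_injective {n N : ℕ} (hn : 3 ≤ n) (hN : N + 1 = 2 * n) :
    Function.Injective fun ab : ZMod N × ZMod N => orbitPerm hN ab.1 ab.2 := by
  rintro ⟨a, b⟩ ⟨a', b'⟩ h
  simp only at h
  have h1 : a + (n : ZMod N) = a' + n := doubleSwap_injective hN hn <| funext fun j => by
    have h2 := gapPerm_orbitPerm hN hn a b j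
    rw [h, gapPerm_orbitPerm hN hn, sub_left_inj, add_left_inj] at h2
    exact h2.symm
  obtain rfl := add_right_cancel h1
  have h2 := DFunLike.congr_fun h a
  rw [orbitPerm_apply, orbitPerm_apply, add_right_inj] at h2
  rw [h2]

/-- Let `n ≥ 3`.  Every `π ∈ M_{2n, C(2n-1,2) - 4}` lies in the orbit of
`[4 2 6 8 … 2n-2 1 3 5 … 2n-1]` (the permutation of `Z_{2n-1}` sending `1 ↦ 4`, `2 ↦ 2` and
`x ↦ 2x` otherwise) under the action `(a,b)·π = C_a(T_b(π))`; consequently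
`|M_{2n, C(2n-1,2) - 4}| = (2n-1)²`. -/
theorem stmt19 (n : ℕ) (hn : 3 ≤ n) :
    (∀ π ∈ Mset n (Nat.choose (2 * n - 1) 2 - 4),
      ∃ a b : ZMod (2 * n - 1), ∀ x : ZMod (2 * n - 1),
        π x = (if x - a = 1 then 4 else if x - a = 2 then 2 else 2 * (x - a)) + b) ∧
    (Mset n (Nat.choose (2 * n - 1) 2 - 4)).ncard = (2 * n - 1) ^ 2 := by
  have hN : 2 * n - 1 + 1 = 2 * n := by omega
  have : NeZero (2 * n - 1) := ⟨by omega⟩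
  refine ⟨fun π hπ => ?_, ?_⟩
  · obtain ⟨a, b, rfl⟩ := exists_eq_orbitPerm hn hN hπ.2
    exact ⟨a, b, orbitPerm_apply hN a b⟩
  · have hrange : Mset n (Nat.choose (2 * n - 1) 2 - 4)
        = (fun ab : ZMod (2 * n - 1) × ZMod (2 * n - 1) => orbitPerm hN ab.1 ab.2) ''
          Set.univ := by
      ext π
      constructor
      · intro hπ
        obtain ⟨a, b, h⟩ := exists_eq_orbitPerm hn hN hπ.2
        exact ⟨(a, b), trivial, h⟩
      · rintro ⟨ab, -, rfl⟩
        exact orbitPerm_mem_Mset hn hN ab.1 ab.2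
    rw [hrange, Set.ncard_image_of_injective _ (orbitPerm_injective hn hN), Set.ncard_univ,
      Nat.card_prod, Nat.card_zmod, sq]
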